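/- Let f be a non wandering positive twist map of the closed annulus A = 𝕋 × [0,1] and let f̃ be a lift of f to Ã = ℝ × [0,1] such that p̃₁(f̃(z̃)) < p̃₁(z̃) for every z̃ ∈ ℝ×{0} and p̃₁(f̃(z̃)) > p̃₁(z̃) for every z̃ ∈ ℝ×{1}. Then there exist at least two distinct points z ≠ z' in A such that every lift of z and every lift of z' is a fixed point of f̃. -/

import Mathlib

open Set Filter Topology MeasureTheory

noncomputable section

/-- The circle `𝕋 = ℝ/ℤ`. -/
abbrev 𝕋 : Type := AddCircle (1 : ℝ)

/-- The closed annulus `A = 𝕋 × [0,1]`. -/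
abbrev Ann : Type := 𝕋 × ↥(Set.Icc (0:ℝ) 1)

/-- The universal cover `Ã = ℝ × [0,1]`. -/
abbrev StripA : Type := ℝ × ↥(Set.Icc (0:ℝ) 1)

/-- The covering projection `π : Ã → A`. -/
def annProj : StripA → Ann := fun z => ((z.1 : 𝕋), z.2)

/-- The deck translation `T(x̃,y) = (x̃+1,y)`. -/
def deckT : StripA → StripA := fun z => (z.1 + 1, z.2)

/-- The iterated deck translation `T^p`, `p ∈ ℤ`. -/
def deckZ (p : ℤ) : StripA → StripA := fun z => (z.1 + (p : ℝ), z.2)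

/-- The boundary circle `C₀ = 𝕋 × {0}`. -/
def C0 : Set Ann := {z | (z.2 : ℝ) = 0}

/-- The boundary circle `C₁ = 𝕋 × {1}`. -/
def C1 : Set Ann := {z | (z.2 : ℝ) = 1}

/-- A point of `Ã` on the boundary line `ℝ × {0}`. -/
def bd0 (x : ℝ) : StripA := (x, ⟨0, by norm_num⟩)

/-- A point of `Ã` on the boundary line `ℝ × {1}`. -/
def bd1 (x : ℝ) : StripA := (x, ⟨1, by norm_num⟩)

/-- A homeomorphism of the closed annulus isotopic to the identity, together with a
chosen lift to the universal cover.  (A homeomorphism of `A` is isotopic to the identity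
iff it admits a lift commuting with the deck translation and preserving each boundary
line of the strip.) -/
structure AnnulusHomeo where
  toFun : Ann ≃ₜ Ann
  lift : StripA ≃ₜ StripA
  lift_proj : ∀ z : StripA, annProj (lift z) = toFun (annProj z)
  lift_deck : ∀ z : StripA, lift (deckT z) = deckT (lift z)
  lift_bd0 : ∀ z : StripA, (z.2 : ℝ) = 0 → ((lift z).2 : ℝ) = 0

/-- The iterate `f^k`, `k ∈ ℤ`. -/
def AnnulusHomeo.iter (h : AnnulusHomeo) (k : ℤ) : Ann → Ann :=
  fun z => ((h.toFun.toEquiv : Equiv.Perm Ann) ^ k) z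

/-- The iterate `f̃^k` of the lift, `k ∈ ℤ`. -/
def AnnulusHomeo.liftIter (h : AnnulusHomeo) (k : ℤ) : StripA → StripA :=
  fun z => ((h.lift.toEquiv : Equiv.Perm StripA) ^ k) z

/-- `f` is non wandering: every nonempty open set meets one of its forward iterates. -/
def NonWandering (h : AnnulusHomeo) : Prop :=
  ∀ U : Set Ann, IsOpen U → U.Nonempty → ∃ k : ℕ, 0 < k ∧ (h.iter k '' U ∩ U).Nonempty

/-- The closed strip `ℝ × [0,1]` inside the plane. -/
def stripS : Set (ℝ × ℝ) := {p | p.2 ∈ Set.Icc (0:ℝ) 1}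

/-- A positive twist map: a `C¹` diffeomorphism of the annulus, isotopic to the identity,
whose lift `F` to the strip (together with its inverse `G`) is continuously differentiable
and satisfies `∂(p̃₁ ∘ f̃)/∂y > 0`, i.e. the first component of `DF(z)·(0,1)` is positive. -/
structure PositiveTwistMap extends AnnulusHomeo where
  F : ℝ × ℝ → ℝ × ℝ
  F' : ℝ × ℝ → (ℝ × ℝ) →L[ℝ] (ℝ × ℝ)
  G : ℝ × ℝ → ℝ × ℝ
  G' : ℝ × ℝ → (ℝ × ℝ) →L[ℝ] (ℝ × ℝ)
  F_lift : ∀ z : StripA, F (z.1, (z.2 : ℝ)) = ((lift z).1, ((lift z).2 : ℝ))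
  G_lift : ∀ z : StripA, G (z.1, (z.2 : ℝ)) = ((lift.symm z).1, ((lift.symm z).2 : ℝ))
  F_hasDeriv : ∀ z ∈ stripS, HasFDerivWithinAt F (F' z) stripS z
  G_hasDeriv : ∀ z ∈ stripS, HasFDerivWithinAt G (G' z) stripS z
  F'_cont : ContinuousOn F' stripS
  G'_cont : ContinuousOn G' stripS
  twist_pos : ∀ z ∈ stripS, 0 < (F' z (0, 1)).1

/-- The oriented angle (in `(-π, π]`) from the vertical vector `(0,1)` to the vector `w`. -/
def angleFromVertical (w : ℝ × ℝ) : ℝ := Complex.arg ⟨w.2, -w.1⟩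

/-- `ρ` is the rotation number of `f` on the boundary circle `C₀`, computed with the lift. -/
def HasRotNum0 (h : AnnulusHomeo) (ρ : ℝ) : Prop :=
  ∀ x : ℝ, Tendsto (fun n : ℕ => ((h.liftIter (n : ℤ) (bd0 x)).1 - x) / (n : ℝ))
    atTop (𝓝 ρ)

/-- `ρ` is the rotation number of `f` on the boundary circle `C₁`, computed with the lift. -/
def HasRotNum1 (h : AnnulusHomeo) (ρ : ℝ) : Prop :=
  ∀ x : ℝ, Tendsto (fun n : ℕ => ((h.liftIter (n : ℤ) (bd1 x)).1 - x) / (n : ℝ))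
    atTop (𝓝 ρ)

/-- A closed `f`-invariant set `X ⊆ A` is well ordered if the first projection is injective
on `X` and the lift preserves the horizontal order on `π⁻¹(X)`. -/
def IsWellOrdered (h : AnnulusHomeo) (X : Set Ann) : Prop :=
  IsClosed X ∧ h.toFun '' X = X ∧
  Set.InjOn (fun z : Ann => z.1) X ∧
  ∀ z₁ z₂ : StripA, annProj z₁ ∈ X → annProj z₂ ∈ X → z₁.1 < z₂.1 →
    (h.lift z₁).1 < (h.lift z₂).1

/-- An essential simple loop in the annulus: the range of an injective continuous map
from the circle that is not null-homotopic. -/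
def IsEssentialSimpleLoop (Γ : Set Ann) : Prop :=
  ∃ γ : C(𝕋, Ann), Function.Injective γ ∧ ¬ γ.Nullhomotopic ∧ Set.range γ = Γ

/-- `Γ` meets each vertical segment `{x} × [0,1]` in exactly one point. -/
def MeetsVerticalsOnce (Γ : Set Ann) : Prop :=
  ∀ x : 𝕋, ∃! z : Ann, z ∈ Γ ∧ z.1 = x

/-- No essential simple loop meeting each vertical segment exactly once is invariant,
except the two boundary circles. -/
def NoInvariantTransverseLoop (h : AnnulusHomeo) : Prop :=
  ∀ Γ : Set Ann, IsEssentialSimpleLoop Γ → MeetsVerticalsOnce Γ →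
    h.toFun '' Γ = Γ → Γ = C0 ∨ Γ = C1

/-- A continuum: a nonempty compact connected set. -/
def IsContinuum (X : Set Ann) : Prop := X.Nonempty ∧ IsCompact X ∧ IsPreconnected X

/-- A lower annulus: an open set homeomorphic to `𝕋 × [0,1)` containing `C₀`. -/
def IsLowerAnnulus (U : Set Ann) : Prop :=
  IsOpen U ∧ Nonempty (↥U ≃ₜ (𝕋 × ↥(Set.Ico (0:ℝ) 1))) ∧ C0 ⊆ U

/-- A lower disk: an open set homeomorphic to `ℝ × [0,1)` meeting `C₀`. -/
def IsLowerDisk (U : Set Ann) : Prop :=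
  IsOpen U ∧ Nonempty (↥U ≃ₜ (ℝ × ↥(Set.Ico (0:ℝ) 1))) ∧ (U ∩ C0).Nonempty

/-- A lower annulus is regular if it is a connected component of the complement of an
essential simple loop. -/
def IsRegularLowerAnnulus (U : Set Ann) : Prop :=
  ∃ Γ : Set Ann, IsEssentialSimpleLoop Γ ∧ ∃ z : Ann, U = connectedComponentIn Γᶜ z

/-- A lower disk is regular if it is a connected component of the complement of a simple
arc joining two points of `C₀` and meeting `C₀` only at its endpoints, or of the
complement of an essential simple loop meeting `C₀` in exactly one point. -/
def IsRegularLowerDisk (U : Set Ann) : Prop :=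
  (∃ a : C(↥(Set.Icc (0:ℝ) 1), Ann), Function.Injective a ∧
      (∀ t : ↥(Set.Icc (0:ℝ) 1), a t ∈ C0 ↔ ((t : ℝ) = 0 ∨ (t : ℝ) = 1)) ∧
      ∃ z : Ann, U = connectedComponentIn (Set.range a)ᶜ z) ∨
  (∃ Γ : Set Ann, IsEssentialSimpleLoop Γ ∧ (∃! z : Ann, z ∈ Γ ∩ C0) ∧
      ∃ z : Ann, U = connectedComponentIn Γᶜ z)

end
/-- Integer translations commute with the lift. -/
theorem AnnulusHomeo.lift_deckZ (h : AnnulusHomeo) (p : ℤ) (z : StripA) :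
    h.lift (deckZ p z) = deckZ p (h.lift z) := by
  induction p using Int.induction_on with
  | zero => simp [deckZ]
  | succ n ih =>
    have e : ∀ w, deckZ ((n : ℤ) + 1) w = deckT (deckZ n w) := fun w => by
      simp [deckZ, deckT, add_assoc]
    rw [e, e, h.lift_deck, ih]
  | pred n ih =>
    have e : ∀ w, deckZ (-(n : ℤ)) w = deckT (deckZ (-(n : ℤ) - 1) w) := fun w => by
      simp [deckZ, deckT, add_assoc]
    rw [e, e, h.lift_deck] at ih
    have inj : Function.Injective deckT := fun a b hab => by
      simp only [deckT, Prod.mk.injEq, add_left_inj] at hab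
      exact Prod.ext hab.1 hab.2
    exact inj ih

theorem annProj_eq_iff {a b : StripA} : annProj a = annProj b ↔ ∃ p : ℤ, a = deckZ p b := by
  constructor
  · intro h
    simp only [annProj, Prod.mk.injEq] at h
    obtain ⟨p, hp⟩ := AddSubgroup.mem_zmultiples_iff.1 (QuotientAddGroup.eq_iff_sub_mem.1 h.1)
    refine ⟨p, Prod.ext ?_ h.2⟩
    simp only [deckZ]
    simp at hp
    linarith
  · rintro ⟨p, rfl⟩
    refine Prod.ext ?_ rfl
    refine QuotientAddGroup.eq_iff_sub_mem.2 (AddSubgroup.mem_zmultiples_iff.2 ⟨p, ?_⟩)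
    simp [deckZ]

theorem isOpenMap_annProj : IsOpenMap annProj :=
  (QuotientAddGroup.isOpenMap_coe (G := ℝ)).prodMap IsOpenMap.id

theorem AnnulusHomeo.iter_annProj (h : AnnulusHomeo) (k : ℕ) (w : StripA) :
    h.iter k (annProj w) = annProj (h.lift^[k] w) := by
  have e : ∀ z, h.iter k z = h.toFun^[k] z := fun z => by
    simp only [AnnulusHomeo.iter, zpow_natCast, Equiv.Perm.coe_pow]
    rfl
  rw [e]
  exact ((Function.Semiconj.iterate_right (f := annProj) h.lift_proj k) w).symm

theorem AnnulusHomeo.fixed_of_annProj_eq (h : AnnulusHomeo) {a w : StripA}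
    (ha : h.lift a = a) (hw : annProj w = annProj a) : h.lift w = w := by
  obtain ⟨p, rfl⟩ := annProj_eq_iff.1 hw
  rw [h.lift_deckZ, ha]

/-- The lift maps the lower boundary line onto itself. -/
theorem AnnulusHomeo.lift_symm_bd0 (h : AnnulusHomeo) (z : StripA) (hz : (z.2 : ℝ) = 0) :
    ((h.lift.symm z).2 : ℝ) = 0 := by
  have hshift : ∀ (p : ℤ) (x : ℝ), (h.lift (bd0 (x + p))).1 = (h.lift (bd0 x)).1 + p :=
    fun p x => congrArg Prod.fst (h.lift_deckZ p (bd0 x))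
  have hc : Continuous fun x : ℝ => (h.lift (bd0 x)).1 := by
    unfold bd0
    fun_prop
  obtain ⟨m, hm⟩ := exists_int_gt (z.1 - (h.lift (bd0 0)).1)
  obtain ⟨n, hn⟩ := exists_int_lt (z.1 - (h.lift (bd0 0)).1)
  obtain ⟨x, hx⟩ := mem_range_of_exists_le_of_exists_ge hc
    (c := z.1) ⟨0 + (n : ℝ), by rw [hshift]; linarith⟩ ⟨0 + (m : ℝ), by rw [hshift]; linarith⟩
  have : h.lift (bd0 x) = z :=
    Prod.ext hx (Subtype.ext ((h.lift_bd0 _ rfl).trans hz.symm))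
  rw [← this, Homeomorph.symm_apply_apply]
  rfl

/-- A continuous self-map of the strip that preserves the lower boundary line and pulls the graph
of `β` back into the graph of `α` maps the region below `α` into the region below `β`. -/
theorem below_graph_of_below_graph {h : StripA → StripA} (hc : Continuous h)
    (hb : ∀ z : StripA, (z.2 : ℝ) = 0 → ((h z).2 : ℝ) = 0) {α β : ℝ → ↥(Set.Icc (0:ℝ) 1)}
    (hβ : Continuous β) (hg : ∀ z, (h z).2 = β (h z).1 → z.2 = α z.1) (z : StripA)
    (hz : z.2 < α z.1) : (h z).2 < β (h z).1 := by
  by_contra! hcon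
  have hc1 : Continuous fun t : ↥(Set.Icc (0:ℝ) 1) => (h (z.1, t)).2 := by fun_prop
  have hc2 : Continuous fun t : ↥(Set.Icc (0:ℝ) 1) => β (h (z.1, t)).1 := by fun_prop
  obtain ⟨t, ht, he⟩ := isPreconnected_Icc.intermediate_value₂ (s := Set.Icc 0 z.2)
    (left_mem_Icc.2 z.2.2.1) (right_mem_Icc.2 z.2.2.1) hc1.continuousOn hc2.continuousOn
    (by
      have : (h (z.1, 0)).2 = 0 := Subtype.ext (hb _ rfl)
      rw [this]
      exact (β _).2.1) hcon
  exact (ht.2.trans_lt hz).ne (hg _ he)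

theorem iterate_below_graph {h : StripA → StripA} {α β : ℝ → ↥(Set.Icc (0:ℝ) 1)}
    (hle : ∀ x, β x ≤ α x) (hm : ∀ z : StripA, z.2 < α z.1 → (h z).2 < β (h z).1)
    {k : ℕ} (hk : 0 < k) (z : StripA) (hz : z.2 < α z.1) : (h^[k] z).2 < β (h^[k] z).1 := by
  induction k, hk using Nat.le_induction with
  | base => exact hm z hz
  | succ n hn ih =>
    rw [Function.iterate_succ_apply']
    exact hm _ (ih.trans_le (hle _))

/-- A nonwandering map has a lift with an orbit returning to any nonempty open periodic set. -/
theorem NonWandering.exists_iterate_lift {h : AnnulusHomeo} (hnw : NonWandering h)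
    {W : Set StripA} (hW : IsOpen W) (hne : W.Nonempty) (hper : ∀ p : ℤ, ∀ z ∈ W, deckZ p z ∈ W) :
    ∃ k : ℕ, 0 < k ∧ ∃ z ∈ W, h.lift^[k] z ∈ W := by
  obtain ⟨k, hk, _, ⟨_, ⟨w, hw, rfl⟩, rfl⟩, v, hv, hvw⟩ :=
    hnw _ (isOpenMap_annProj W hW) (hne.image _)
  rw [h.iter_annProj] at hvw
  obtain ⟨p, hp⟩ := annProj_eq_iff.1 hvw.symm
  exact ⟨k, hk, w, hw, hp ▸ hper p v hv⟩

/-- The horizontal displacement of a positive twist map increases along vertical segments. -/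
theorem PositiveTwistMap.strictMono_lift_fst (f : PositiveTwistMap) (x : ℝ) :
    StrictMono fun t : ↥(Set.Icc (0:ℝ) 1) => (f.lift (x, t)).1 := by
  have hd : ∀ y ∈ Set.Icc (0:ℝ) 1, HasDerivWithinAt (fun y => (f.F (x, y)).1)
      (f.F' (x, y) (0, 1)).1 (Set.Icc 0 1) y := by
    intro y hy
    have h1 : HasDerivWithinAt (fun y : ℝ => ((x, y) : ℝ × ℝ)) (0, 1) (Set.Icc 0 1) y :=
      (hasDerivWithinAt_const y _ x).prodMk (hasDerivWithinAt_id y _)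
    have h2 := (f.F_hasDeriv (x, y) hy).comp_hasDerivWithinAt y h1 (fun _ ht => ht)
    exact (hasFDerivAt_fst (𝕜 := ℝ) (p := f.F (x, y))).comp_hasDerivWithinAt y h2
  have hmono : StrictMonoOn (fun y => (f.F (x, y)).1) (Set.Icc 0 1) := by
    refine strictMonoOn_of_hasDerivWithinAt_pos (f' := fun y => (f.F' (x, y) (0, 1)).1)
      (convex_Icc 0 1) (fun y hy => (hd y hy).continuousWithinAt)
      (fun y hy => (hd y (interior_subset hy)).mono interior_subset)
      (fun y hy => f.twist_pos (x, y) (show y ∈ Set.Icc (0:ℝ) 1 from interior_subset hy))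
  intro s t hst
  have := hmono s.2 t.2 hst
  have e : ∀ t : ↥(Set.Icc (0:ℝ) 1), (f.F (x, (t : ℝ))).1 = (f.lift (x, t)).1 := fun t =>
    congrArg Prod.fst (f.F_lift (x, t))
  simpa only [e] using this

/-- The points moved vertically by the lift form the graph of a continuous function. -/
theorem PositiveTwistMap.exists_vertical_graph (f : PositiveTwistMap)
    (hbd0 : ∀ z : StripA, (z.2 : ℝ) = 0 → (f.lift z).1 < z.1)
    (hbd1 : ∀ z : StripA, (z.2 : ℝ) = 1 → z.1 < (f.lift z).1) :
    ∃ φ : ℝ → ↥(Set.Icc (0:ℝ) 1), Continuous φ ∧ ∀ x t, (f.lift (x, t)).1 = x ↔ t = φ x := by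
  have hex : ∀ x : ℝ, ∃ t : ↥(Set.Icc (0:ℝ) 1), (f.lift (x, t)).1 = x := fun x =>
    mem_range_of_exists_le_of_exists_ge
      (by fun_prop : Continuous fun t : ↥(Set.Icc (0:ℝ) 1) => (f.lift (x, t)).1)
      ⟨0, (hbd0 (x, 0) rfl).le⟩ ⟨1, (hbd1 (x, 1) rfl).le⟩
  choose φ hφ using hex
  have hiff : ∀ x t, (f.lift (x, t)).1 = x ↔ t = φ x := fun x t =>
    ⟨fun h => (f.strictMono_lift_fst x).injective (h.trans (hφ x).symm), fun h => h ▸ hφ x⟩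
  refine ⟨φ, ?_, hiff⟩
  refine continuous_iff_isClosed.2 fun s hs => ?_
  have heq : φ ⁻¹' s = Prod.fst '' ({p : StripA | (f.lift p).1 = p.1} ∩ Prod.snd ⁻¹' s) := by
    ext x
    constructor
    · exact fun hx => ⟨(x, φ x), ⟨hφ x, hx⟩, rfl⟩
    · rintro ⟨⟨x, t⟩, ⟨ht, hts⟩, rfl⟩
      obtain rfl := (hiff x t).1 ht
      exact hts
  rw [heq]
  exact isClosedMap_fst_of_compactSpace _
    ((isClosed_eq (by fun_prop) (by fun_prop)).inter (hs.preimage continuous_snd))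

/-- A continuous periodic function with at most one zero modulo `1` has constant sign and is not
identically zero. -/
theorem exists_two_zeros_or_sign {δ : ℝ → ℝ} (hδ : Continuous δ)
    (hper : ∀ (p : ℤ) x, δ (x + p) = δ x) :
    (∃ x y, x < y ∧ y < x + 1 ∧ δ x = 0 ∧ δ y = 0) ∨ (∃ x, 0 < δ x) ∧ (∀ x, 0 ≤ δ x) ∨
      (∃ x, δ x < 0) ∧ ∀ x, δ x ≤ 0 := by
  by_cases h1 : ∃ a, 0 < δ a <;> by_cases h2 : ∃ b, δ b < 0
  · obtain ⟨a, ha⟩ := h1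
    obtain ⟨b, hb⟩ := h2
    left
    have hb' : δ (b + (-⌊b - a⌋ : ℤ)) < 0 := by rwa [hper]
    have hab : a ≤ b + (-⌊b - a⌋ : ℤ) := by
      push_cast
      linarith [Int.floor_le (b - a)]
    have hba : b + (-⌊b - a⌋ : ℤ) ≤ a + 1 := by
      push_cast
      linarith [Int.lt_floor_add_one (b - a)]
    have ha' : 0 < δ (a + 1) := by
      have := hper 1 a
      rw [Int.cast_one] at this
      rwa [this]
    obtain ⟨x, hx, hx0⟩ := intermediate_value_Ioo' hab hδ.continuousOn ⟨hb', ha⟩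
    obtain ⟨y, hy, hy0⟩ := intermediate_value_Ioo hba hδ.continuousOn ⟨hb', ha'⟩
    exact ⟨x, y, hx.2.trans hy.1, by linarith [hx.1, hy.2], hx0, hy0⟩
  · push Not at h2
    exact Or.inr (Or.inl ⟨h1, h2⟩)
  · push Not at h1
    exact Or.inr (Or.inr ⟨h2, h1⟩)
  · push Not at h1 h2
    exact Or.inl ⟨0, 1 / 2, by norm_num, by norm_num, le_antisymm (h1 _) (h2 _),
      le_antisymm (h1 _) (h2 _)⟩

/-- **Poincaré–Birkhoff theorem for twist maps.** A non wandering positive twist map whose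
lift moves the lower boundary to the left and the upper boundary to the right has at least
two distinct points lifted to fixed points of the lift. -/
theorem statement4 (f : PositiveTwistMap) (hnw : NonWandering f.toAnnulusHomeo)
    (hbd0 : ∀ z : StripA, (z.2 : ℝ) = 0 → (f.lift z).1 < z.1)
    (hbd1 : ∀ z : StripA, (z.2 : ℝ) = 1 → z.1 < (f.lift z).1) :
    ∃ z z' : Ann, z ≠ z' ∧
      (∀ w : StripA, annProj w = z → f.lift w = w) ∧
      (∀ w : StripA, annProj w = z' → f.lift w = w) := by
  obtain ⟨φ, hφc, hφ⟩ := f.exists_vertical_graph hbd0 hbd1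
  have hφl : ∀ x, (f.lift (x, φ x)).1 = x := fun x => (hφ x _).2 rfl
  obtain ⟨ψ, hψc, hψ⟩ : ∃ ψ : ℝ → ↥(Set.Icc (0:ℝ) 1), Continuous ψ ∧
      ∀ x, f.lift (x, φ x) = (x, ψ x) :=
    ⟨fun x => (f.lift (x, φ x)).2, by fun_prop, fun x => Prod.ext (hφl x) rfl⟩
  have hφp : ∀ (p : ℤ) x, φ (x + p) = φ x := fun p x => by
    refine ((hφ _ _).1 ?_).symm
    have := congrArg Prod.fst (f.lift_deckZ p (x, φ x))
    rw [hψ] at this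
    exact this
  have hψp : ∀ (p : ℤ) x, ψ (x + p) = ψ x := fun p x => by
    have := f.lift_deckZ p (x, φ x)
    rw [hψ] at this
    simp only [deckZ] at this
    rw [← hφp p x, hψ] at this
    exact congrArg Prod.snd this
  have hlow : ∀ z : StripA, z.2 < φ z.1 → (f.lift z).2 < ψ (f.lift z).1 :=
    below_graph_of_below_graph f.lift.continuous f.lift_bd0 hψc fun z hz => by
      have : f.lift z = f.lift ((f.lift z).1, φ (f.lift z).1) := by
        rw [hψ]
        exact Prod.ext rfl hz
      have := f.lift.injective this
      generalize (f.lift z).1 = x at this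
      rw [this]
  have hupp : ∀ z : StripA, z.2 < ψ z.1 → (f.lift.symm z).2 < φ (f.lift.symm z).1 :=
    below_graph_of_below_graph f.lift.symm.continuous f.lift_symm_bd0 hφc fun z hz => by
      have : f.lift (f.lift.symm z) = _ :=
        (congrArg f.lift (Prod.ext rfl hz : f.lift.symm z =
          ((f.lift.symm z).1, φ (f.lift.symm z).1))).trans (hψ _)
      rw [f.lift.apply_symm_apply] at this
      generalize (f.lift.symm z).1 = x at this
      rw [this]
  have hopen : ∀ α β : ℝ → ↥(Set.Icc (0:ℝ) 1), Continuous α → Continuous β →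
      IsOpen {z : StripA | β z.1 < z.2 ∧ z.2 < α z.1} := fun α β hα hβ =>
    (isOpen_lt (f := fun z : StripA => β z.1) (by fun_prop) continuous_snd).inter
      (isOpen_lt (g := fun z : StripA => α z.1) continuous_snd (by fun_prop))
  have hnonempty : ∀ (α β : ℝ → ↥(Set.Icc (0:ℝ) 1)) (x : ℝ), β x < α x →
      {z : StripA | β z.1 < z.2 ∧ z.2 < α z.1}.Nonempty := fun α β x hx => by
    obtain ⟨t, ht⟩ := exists_between hx
    exact ⟨(x, t), ht⟩
  rcases exists_two_zeros_or_sign (δ := fun x => (φ x : ℝ) - ψ x) (by fun_prop)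
    (fun p x => by simp only [hφp, hψp]) with
    ⟨x, y, hxy, hyx, hx, hy⟩ | ⟨⟨x, hx⟩, hle⟩ | ⟨⟨x, hx⟩, hle⟩
  · have hfix : ∀ x, (φ x : ℝ) - ψ x = 0 → f.lift (x, φ x) = (x, φ x) := fun x hx => by
      rw [hψ, Subtype.ext (sub_eq_zero.1 hx)]
    refine ⟨annProj (x, φ x), annProj (y, φ y), fun h => ?_,
      fun w => f.fixed_of_annProj_eq (hfix x hx), fun w => f.fixed_of_annProj_eq (hfix y hy)⟩
    obtain ⟨p, hp⟩ := annProj_eq_iff.1 h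
    have hp : x = y + p := congrArg Prod.fst hp
    have h1 : (p : ℝ) < 0 := by linarith
    have h2 : (-1 : ℝ) < p := by linarith
    norm_cast at h1 h2
    omega
  · exfalso
    obtain ⟨k, hk, z, hz, hkz⟩ := hnw.exists_iterate_lift (hopen φ ψ hφc hψc)
      (hnonempty φ ψ x (Subtype.coe_lt_coe.1 (sub_pos.1 hx)))
      (fun p z hz => by simpa [deckZ, hφp, hψp] using hz)
    have := iterate_below_graph (fun x => Subtype.coe_le_coe.1 (sub_nonneg.1 (hle x))) hlow hk z hz.2
    exact this.not_gt hkz.1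
  · exfalso
    obtain ⟨k, hk, z, hz, hkz⟩ := hnw.exists_iterate_lift (hopen ψ φ hψc hφc)
      (hnonempty ψ φ x (Subtype.coe_lt_coe.1 (sub_neg.1 hx)))
      (fun p z hz => by simpa [deckZ, hφp, hψp] using hz)
    have := iterate_below_graph (fun x => Subtype.coe_le_coe.1 (sub_nonpos.1 (hle x))) hupp hk _ hkz.2
    rw [Function.LeftInverse.iterate f.lift.symm_apply_apply k z] at this
    exact this.not_gt hz.1
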